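/- Let α = (a_1, ..., a_n) with n ≥ 2 be a sharp, zero-sum-free sequence of elements of an abelian group, and let s ≥ 1 be the integer such that the set of sums of nonempty subsequences of α_{n−1} is the union of the progression {a_n, 2a_n, ..., s·a_n} and a collection of cosets of ⟨a_n⟩ distinct from ⟨a_n⟩ itself. Then σ(α_{n−1}) = s·a_n, i.e., a_1 + ... + a_{n−1} = s·a_n. -/

import Mathlib

/-- The set of all subsequence sums of a list (including the sum 0 of the empty
subsequence). -/
def subSums {G : Type*} [AddCommMonoid G] [DecidableEq G] (l : List G) : Finset G :=
  (l.sublists.map List.sum).toFinset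

/-- A sequence is zero-sum-free if no nonempty subsequence sums to zero. -/
def ZeroSumFree {G : Type*} [AddCommMonoid G] (l : List G) : Prop :=
  ∀ t : List G, t.Sublist l → t ≠ [] → t.sum ≠ 0

/-- A sequence `α` of length `n` is sharp if `Σ(α) = Σ(α_{n-1}) ∪ {σ(α)}`. -/
def IsSharp {G : Type*} [AddCommMonoid G] [DecidableEq G] (l : List G) : Prop :=
  subSums l = subSums l.dropLast ∪ {l.sum}

/-- The set of sums of nonempty subsequences of a list. -/
def nonemptySubSums {G : Type*} [AddCommMonoid G] (l : List G) : Set G :=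
  {x | ∃ t : List G, t.Sublist l ∧ t ≠ [] ∧ t.sum = x}

/-- **Claim (Smith–Freeze, Savchev–Chen, part (b)).** If `α = l ++ [c]` (with `n ≥ 2`)
is a sharp zero-sum-free sequence and `s ≥ 1` is such that the set of nonempty
subsequence sums of `α_{n-1} = l` is the union of the progression `{c, 2c, ..., s·c}`
and a collection of cosets of `⟨c⟩` distinct from `⟨c⟩` itself, then
`σ(α_{n-1}) = s·c`. -/
theorem sharp_sum_eq {G : Type*} [AddCommGroup G] [DecidableEq G]
    (l : List G) (c : G) (hl : l ≠ [])
    (hzsf : ZeroSumFree (l ++ [c])) (hsharp : IsSharp (l ++ [c]))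
    (s : ℕ) (hs : 1 ≤ s) (S : Set G)
    (hS : ∀ g ∈ S, g ∉ AddSubgroup.zmultiples c)
    (hdecomp : nonemptySubSums l =
      ((fun k : ℕ => k • c) '' Set.Icc 1 s) ∪
        ⋃ g ∈ S, ((g + ·) '' (AddSubgroup.zmultiples c : Set G))) :
    l.sum = s • c := by
  have mem_of_mem : ∀ k : ℕ, 1 ≤ k → k ≤ s → k • c ∈ nonemptySubSums l := fun k h1 h2 => by
    rw [hdecomp]
    exact Or.inl ⟨k, ⟨h1, h2⟩, rfl⟩
  have smul_ne_zero : ∀ k : ℕ, 1 ≤ k → k ≤ s + 1 → k • c ≠ 0 := by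
    intro k h1 h2 h0
    obtain rfl | h2 := h2.eq_or_lt
    · obtain ⟨t, ht, -, hts⟩ := mem_of_mem s hs le_rfl
      exact hzsf (t ++ [c]) (ht.append_right [c]) (by simp) (by
        rw [List.sum_append, hts, List.sum_singleton, ← succ_nsmul, h0])
    · obtain ⟨t, ht, hne, hts⟩ := mem_of_mem k h1 (by lia)
      exact hzsf t (ht.trans (List.sublist_append_left l [c])) hne (hts.trans h0)
  have hmem : (s + 1) • c ∈ subSums (l ++ [c]) := by
    obtain ⟨t, ht, -, hts⟩ := mem_of_mem s hs le_rfl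
    simp only [subSums, List.mem_toFinset, List.mem_map, List.mem_sublists]
    exact ⟨t ++ [c], ht.append_right [c], by
      rw [List.sum_append, hts, List.sum_singleton, succ_nsmul]⟩
  rw [hsharp, List.dropLast_concat, Finset.mem_union, Finset.mem_singleton, List.sum_append,
    List.sum_singleton, succ_nsmul] at hmem
  refine hmem.elim (fun h => ?_) fun h => (add_right_cancel h).symm
  rw [← succ_nsmul] at h
  simp only [subSums, List.mem_toFinset, List.mem_map, List.mem_sublists] at h
  obtain ⟨t, ht, hts⟩ := h
  obtain rfl | hne := eq_or_ne t []
  · exact absurd hts.symm (smul_ne_zero (s + 1) (by lia) le_rfl)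
  have hin : (s + 1) • c ∈ nonemptySubSums l := ⟨t, ht, hne, hts⟩
  rw [hdecomp] at hin
  obtain ⟨k, ⟨h1, h2⟩, hk⟩ | hin := hin
  · refine absurd ?_ (smul_ne_zero (s + 1 - k) (by lia) (by lia))
    rw [sub_nsmul c (by lia : k ≤ s + 1), ← hk, add_neg_cancel]
  · simp only [Set.mem_iUnion] at hin
    obtain ⟨g, hg, z, hz, hgz⟩ := hin
    refine absurd ?_ (hS g hg)
    rw [eq_sub_of_add_eq hgz]
    exact sub_mem (nsmul_mem (AddSubgroup.mem_zmultiples c) _) hz
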